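/- The image of Φ_1 equals the set of locally finite elements U_q^{lf} = {x ∈ U_q : the ℂ(q)-linear span of ad^r(U_q)(x) is finite dimensional}. -/

import Mathlib

noncomputable section

open scoped TensorProduct

abbrev Kq : Type := RatFunc ℂ

/-- The indeterminate `q`. -/
noncomputable def qv : Kq := RatFunc.X

/-- Generators `a`, `b`, `c`, `d` of the algebra `𝒜 = ℒ_{0,1}(sl(2))`. -/
inductive AGen : Type
  | a | b | c | d

/-- The defining relations of `𝒜 = ℒ_{0,1}(sl(2))`. -/
inductive ARel : FreeAlgebra Kq AGen → FreeAlgebra Kq AGen → Prop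
  | ad_comm : ARel (FreeAlgebra.ι Kq AGen.a * FreeAlgebra.ι Kq AGen.d)
      (FreeAlgebra.ι Kq AGen.d * FreeAlgebra.ι Kq AGen.a)
  | db : ARel (FreeAlgebra.ι Kq AGen.d * FreeAlgebra.ι Kq AGen.b)
      ((qv ^ 2) • (FreeAlgebra.ι Kq AGen.b * FreeAlgebra.ι Kq AGen.d))
  | cd : ARel (FreeAlgebra.ι Kq AGen.c * FreeAlgebra.ι Kq AGen.d)
      ((qv ^ 2) • (FreeAlgebra.ι Kq AGen.d * FreeAlgebra.ι Kq AGen.c))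
  | ab : ARel (FreeAlgebra.ι Kq AGen.a * FreeAlgebra.ι Kq AGen.b
        - FreeAlgebra.ι Kq AGen.b * FreeAlgebra.ι Kq AGen.a)
      ((-(1 - qv⁻¹ ^ 2)) • (FreeAlgebra.ι Kq AGen.b * FreeAlgebra.ι Kq AGen.d))
  | cb : ARel (FreeAlgebra.ι Kq AGen.c * FreeAlgebra.ι Kq AGen.b
        - FreeAlgebra.ι Kq AGen.b * FreeAlgebra.ι Kq AGen.c)
      ((1 - qv⁻¹ ^ 2) • (FreeAlgebra.ι Kq AGen.d * FreeAlgebra.ι Kq AGen.a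
        - FreeAlgebra.ι Kq AGen.d * FreeAlgebra.ι Kq AGen.d))
  | ac : ARel (FreeAlgebra.ι Kq AGen.a * FreeAlgebra.ι Kq AGen.c
        - FreeAlgebra.ι Kq AGen.c * FreeAlgebra.ι Kq AGen.a)
      ((1 - qv⁻¹ ^ 2) • (FreeAlgebra.ι Kq AGen.d * FreeAlgebra.ι Kq AGen.c))
  | det : ARel (FreeAlgebra.ι Kq AGen.a * FreeAlgebra.ι Kq AGen.d
        - (qv ^ 2) • (FreeAlgebra.ι Kq AGen.b * FreeAlgebra.ι Kq AGen.c)) 1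

/-- The algebra `𝒜 = ℒ_{0,1}(sl(2))`, presented by generators and relations. -/
abbrev Aalg : Type := RingQuot ARel

noncomputable def aA : Aalg := RingQuot.mkAlgHom Kq ARel (FreeAlgebra.ι Kq AGen.a)
noncomputable def bA : Aalg := RingQuot.mkAlgHom Kq ARel (FreeAlgebra.ι Kq AGen.b)
noncomputable def cA : Aalg := RingQuot.mkAlgHom Kq ARel (FreeAlgebra.ι Kq AGen.c)
noncomputable def dA : Aalg := RingQuot.mkAlgHom Kq ARel (FreeAlgebra.ι Kq AGen.d)

/-- The element `ω = q a + q⁻¹ d`. -/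
noncomputable def ωA : Aalg := qv • aA + qv⁻¹ • dA

/-- Generators `E`, `F`, `K`, `K⁻¹` of the quantum group `U_q(sl(2))`. -/
inductive UGen : Type
  | E | F | K | Kinv

/-- The defining relations of `U_q(sl(2))`. -/
inductive URel : FreeAlgebra Kq UGen → FreeAlgebra Kq UGen → Prop
  | KKinv : URel (FreeAlgebra.ι Kq UGen.K * FreeAlgebra.ι Kq UGen.Kinv) 1
  | KinvK : URel (FreeAlgebra.ι Kq UGen.Kinv * FreeAlgebra.ι Kq UGen.K) 1
  | KE : URel (FreeAlgebra.ι Kq UGen.K * FreeAlgebra.ι Kq UGen.E * FreeAlgebra.ι Kq UGen.Kinv)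
      ((qv ^ 2) • FreeAlgebra.ι Kq UGen.E)
  | KF : URel (FreeAlgebra.ι Kq UGen.K * FreeAlgebra.ι Kq UGen.F * FreeAlgebra.ι Kq UGen.Kinv)
      ((qv⁻¹ ^ 2) • FreeAlgebra.ι Kq UGen.F)
  | EF : URel (FreeAlgebra.ι Kq UGen.E * FreeAlgebra.ι Kq UGen.F
        - FreeAlgebra.ι Kq UGen.F * FreeAlgebra.ι Kq UGen.E)
      (((qv - qv⁻¹)⁻¹) • (FreeAlgebra.ι Kq UGen.K - FreeAlgebra.ι Kq UGen.Kinv))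

/-- The quantum group `U_q = U_q(sl(2))`, presented by generators and relations. -/
abbrev Uq : Type := RingQuot URel

noncomputable def Eel : Uq := RingQuot.mkAlgHom Kq URel (FreeAlgebra.ι Kq UGen.E)
noncomputable def Fel : Uq := RingQuot.mkAlgHom Kq URel (FreeAlgebra.ι Kq UGen.F)
noncomputable def Kel : Uq := RingQuot.mkAlgHom Kq URel (FreeAlgebra.ι Kq UGen.K)
noncomputable def Kinvel : Uq := RingQuot.mkAlgHom Kq URel (FreeAlgebra.ι Kq UGen.Kinv)

/-- The bilinear map `(u, v) ↦ S(u) * x * v` underlying the right adjoint action. -/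
noncomputable def adrBil (Smap : Uq →ₗ[Kq] Uq) (x : Uq) : Uq →ₗ[Kq] Uq →ₗ[Kq] Uq :=
  LinearMap.mk₂ Kq (fun u v => Smap u * x * v)
    (fun u u' v => by simp only [map_add, add_mul])
    (fun cc u v => by simp only [map_smul, smul_mul_assoc])
    (fun u v v' => by simp only [mul_add])
    (fun cc u v => by simp only [mul_smul_comm])

/-- The right adjoint action `ad^r(y)(x) = Σ S(y₍₁₎) x y₍₂₎` (Sweedler notation),
defined via the coproduct `Δ` and the antipode `S`. -/
noncomputable def adr (Smap : Uq →ₗ[Kq] Uq) (Δmap : Uq →ₐ[Kq] Uq ⊗[Kq] Uq)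
    (y x : Uq) : Uq :=
  TensorProduct.lift (adrBil Smap x) (Δmap y)

/-! ### Scalars -/

theorem qv_ne_zero : qv ≠ 0 := RatFunc.X_ne_zero

theorem qv_pow_ne_one {n : ℕ} (hn : n ≠ 0) : qv ^ n ≠ 1 := by
  intro h
  have h' : (Polynomial.X ^ n : Polynomial ℂ) = 1 := by
    apply RatFunc.algebraMap_injective ℂ
    simpa [qv] using h
  have := congrArg Polynomial.natDegree h'
  simp at this
  exact hn this

theorem qv_sq_sub_one_ne_zero : qv ^ 2 - 1 ≠ 0 := sub_ne_zero.2 (qv_pow_ne_one two_ne_zero)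

theorem qv_sub_inv_ne_zero : qv - qv⁻¹ ≠ 0 := by
  have h : qv - qv⁻¹ = (qv ^ 2 - 1) / qv := by
    have := qv_ne_zero
    field_simp
  rw [h]
  exact div_ne_zero qv_sq_sub_one_ne_zero qv_ne_zero

/-- The ring structure on `U_q`, built on the semiring structure of `RingQuot` so that the two
agree up to reducible unfolding. -/
abbrev uqRing : Ring Uq :=
  { RingQuot.instSemiring URel with
    neg := fun x => -x
    sub := fun x y => x - y
    sub_eq_add_neg := fun x y => (RingQuot.instRing URel).sub_eq_add_neg x y
    neg_add_cancel := fun x => (RingQuot.instRing URel).neg_add_cancel x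
    zsmul := zsmulRec
    intCast := Int.castDef
    intCast_ofNat := fun _ => rfl
    intCast_negSucc := fun _ => rfl }

section

attribute [local instance] uqRing Semiring.toNatAlgebra Ring.toIntAlgebra

/-! ### Straightening relations in `U_q` -/

theorem Kel_mul_Kinvel : Kel * Kinvel = 1 := by
  have h := RingQuot.mkAlgHom_rel Kq URel.KKinv
  simp only [map_mul, map_one] at h
  exact h

theorem Kinvel_mul_Kel : Kinvel * Kel = 1 := by
  have h := RingQuot.mkAlgHom_rel Kq URel.KinvK
  simp only [map_mul, map_one] at h
  exact h

theorem Kel_mul_Kinvel_mul (x : Uq) : Kel * (Kinvel * x) = x := by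
  rw [← mul_assoc, Kel_mul_Kinvel, one_mul]

theorem Kinvel_mul_Kel_mul (x : Uq) : Kinvel * (Kel * x) = x := by
  rw [← mul_assoc, Kinvel_mul_Kel, one_mul]

theorem Kel_mul_Eel_mul_Kinvel : Kel * Eel * Kinvel = qv ^ 2 • Eel := by
  have h := RingQuot.mkAlgHom_rel Kq URel.KE
  simp only [map_mul, map_smul] at h
  exact h

theorem Kel_mul_Fel_mul_Kinvel : Kel * Fel * Kinvel = qv⁻¹ ^ 2 • Fel := by
  have h := RingQuot.mkAlgHom_rel Kq URel.KF
  simp only [map_mul, map_smul] at h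
  exact h

theorem Eel_mul_Fel :
    Eel * Fel = Fel * Eel + (qv - qv⁻¹)⁻¹ • (Kel - Kinvel) := by
  have h := RingQuot.mkAlgHom_rel Kq URel.EF
  simp only [map_mul, map_smul, map_sub] at h
  exact sub_eq_iff_eq_add'.1 h

theorem Eel_mul_Kel : Eel * Kel = (qv⁻¹ ^ 2) • (Kel * Eel) := by
  have h := congrArg (· * Kel) Kel_mul_Eel_mul_Kinvel
  simp only [mul_assoc, Kinvel_mul_Kel, mul_one, smul_mul_assoc] at h
  rw [h, smul_smul, ← mul_pow, inv_mul_cancel₀ qv_ne_zero, one_pow, one_smul]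

theorem Eel_mul_Kinvel : Eel * Kinvel = (qv ^ 2) • (Kinvel * Eel) := by
  have h := congrArg (Kinvel * ·) Kel_mul_Eel_mul_Kinvel
  simpa only [mul_assoc, Kinvel_mul_Kel_mul, mul_smul_comm] using h

theorem Kel_mul_Fel : Kel * Fel = (qv⁻¹ ^ 2) • (Fel * Kel) := by
  have h := congrArg (· * Kel) Kel_mul_Fel_mul_Kinvel
  simpa only [mul_assoc, Kinvel_mul_Kel, mul_one, smul_mul_assoc] using h

theorem Kinvel_mul_Fel : Kinvel * Fel = (qv ^ 2) • (Fel * Kinvel) := by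
  have h := congrArg (Kinvel * ·) Kel_mul_Fel_mul_Kinvel
  simp only [mul_assoc, Kinvel_mul_Kel_mul, mul_smul_comm] at h
  rw [h, smul_smul, ← mul_pow, mul_inv_cancel₀ qv_ne_zero, one_pow, one_smul]

theorem Eel_mul_Fel_mul (x : Uq) :
    Eel * (Fel * x) = Fel * (Eel * x) + (qv - qv⁻¹)⁻¹ • (Kel * x - Kinvel * x) := by
  rw [← mul_assoc, Eel_mul_Fel, add_mul, smul_mul_assoc, sub_mul, mul_assoc]

theorem Eel_mul_Kinvel_mul (x : Uq) :
    Eel * (Kinvel * x) = (qv ^ 2) • (Kinvel * (Eel * x)) := by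
  rw [← mul_assoc, Eel_mul_Kinvel, smul_mul_assoc, mul_assoc]

theorem Kel_mul_Fel_mul (x : Uq) : Kel * (Fel * x) = (qv⁻¹ ^ 2) • (Fel * (Kel * x)) := by
  rw [← mul_assoc, Kel_mul_Fel, smul_mul_assoc, mul_assoc]

theorem Kinvel_mul_Fel_mul (x : Uq) :
    Kinvel * (Fel * x) = (qv ^ 2) • (Fel * (Kinvel * x)) := by
  rw [← mul_assoc, Kinvel_mul_Fel, smul_mul_assoc, mul_assoc]

theorem Fel_mul_Kinvel_pow (n : ℕ) :
    Fel * Kinvel ^ n = (qv⁻¹ ^ 2) ^ n • (Kinvel ^ n * Fel) := by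
  have h : Fel * Kinvel = (qv⁻¹ ^ 2) • (Kinvel * Fel) := by
    rw [Kinvel_mul_Fel, smul_smul, ← mul_pow, inv_mul_cancel₀ qv_ne_zero, one_pow, one_smul]
  induction n with
  | zero => simp
  | succ n ih =>
    rw [pow_succ, ← mul_assoc, ih, smul_mul_assoc, mul_assoc, h, mul_smul_comm, smul_smul,
      ← pow_succ, ← mul_assoc]

/-! ### The subalgebra generated by the images of `a`, `b`, `c`, `d` -/

/-- The image of `a` under `Φ₁`. -/
def aU : Uq := Kel + (qv⁻¹ * (qv - qv⁻¹) ^ 2) • (Fel * Eel)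

/-- The image of `c` under `Φ₁`, up to a nonzero scalar. -/
def cU : Uq := Kinvel * Eel

/-- The subalgebra of `U_q` generated by the images of `a`, `b`, `c`, `d` under `Φ₁`. -/
def imageSubalgebra : Subalgebra Kq Uq := Algebra.adjoin Kq {aU, Fel, cU, Kinvel}

theorem aU_mem : aU ∈ imageSubalgebra := Algebra.subset_adjoin (by simp)
theorem Fel_mem : Fel ∈ imageSubalgebra := Algebra.subset_adjoin (by simp)
theorem cU_mem : cU ∈ imageSubalgebra := Algebra.subset_adjoin (by simp)
theorem Kinvel_mem : Kinvel ∈ imageSubalgebra := Algebra.subset_adjoin (by simp)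

/-- Conjugation `x ↦ K x K⁻¹`. -/
def conjK : Uq →ₐ[Kq] Uq :=
  AlgHom.ofLinearMap (LinearMap.mulLeft Kq Kel ∘ₗ LinearMap.mulRight Kq Kinvel)
    (by simp [Kel_mul_Kinvel])
    (fun x y => by simp [mul_assoc, Kinvel_mul_Kel_mul])

/-- Conjugation `x ↦ K⁻¹ x K`. -/
def conjKinv : Uq →ₐ[Kq] Uq :=
  AlgHom.ofLinearMap (LinearMap.mulLeft Kq Kinvel ∘ₗ LinearMap.mulRight Kq Kel)
    (by simp [Kinvel_mul_Kel])
    (fun x y => by simp [mul_assoc, Kel_mul_Kinvel_mul])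

theorem conjK_apply (x : Uq) : conjK x = Kel * (x * Kinvel) := rfl
theorem conjKinv_apply (x : Uq) : conjKinv x = Kinvel * (x * Kel) := rfl

theorem conjK_aU : conjK aU = aU := by
  simp only [conjK_apply, aU, mul_assoc, mul_add, add_mul, smul_mul_assoc, mul_smul_comm,
    Eel_mul_Kinvel, Kel_mul_Fel_mul, Kel_mul_Kinvel_mul, Kel_mul_Kinvel, mul_one]
  have := qv_ne_zero
  match_scalars <;> field_simp

theorem conjK_Fel : conjK Fel = (qv⁻¹ ^ 2) • Fel := by
  rw [conjK_apply, ← mul_assoc, Kel_mul_Fel_mul_Kinvel]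

theorem conjK_cU : conjK cU = (qv ^ 2) • cU := by
  simp only [conjK_apply, cU, mul_assoc, Kel_mul_Kinvel_mul, Eel_mul_Kinvel]

theorem conjK_Kinvel : conjK Kinvel = Kinvel := by
  rw [conjK_apply, Kel_mul_Kinvel_mul]

theorem conjKinv_conjK (x : Uq) : conjKinv (conjK x) = x := by
  simp [conjK_apply, conjKinv_apply, mul_assoc, Kinvel_mul_Kel, Kinvel_mul_Kel_mul]

theorem conjKinv_eq_of_conjK_eq {x : Uq} {t : Kq} (ht : t ≠ 0) (h : conjK x = t • x) :
    conjKinv x = t⁻¹ • x := by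
  rw [eq_inv_smul_iff₀ ht, ← map_smul, ← h, conjKinv_conjK]

theorem conjKinv_aU : conjKinv aU = aU := by
  conv_lhs => rw [← conjK_aU]
  exact conjKinv_conjK _

theorem conjKinv_Kinvel : conjKinv Kinvel = Kinvel := by
  conv_lhs => rw [← conjK_Kinvel]
  exact conjKinv_conjK _

theorem conjKinv_Fel : conjKinv Fel = (qv⁻¹ ^ 2)⁻¹ • Fel :=
  conjKinv_eq_of_conjK_eq (pow_ne_zero _ (inv_ne_zero qv_ne_zero)) conjK_Fel

theorem conjKinv_cU : conjKinv cU = (qv ^ 2)⁻¹ • cU :=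
  conjKinv_eq_of_conjK_eq (pow_ne_zero _ qv_ne_zero) conjK_cU

theorem conjK_mem {x : Uq} (hx : x ∈ imageSubalgebra) : conjK x ∈ imageSubalgebra := by
  suffices imageSubalgebra ≤ imageSubalgebra.comap conjK from this hx
  refine Algebra.adjoin_le ?_
  rintro _ (rfl | rfl | rfl | rfl)
  · simpa [conjK_aU] using aU_mem
  · simpa [conjK_Fel] using imageSubalgebra.smul_mem Fel_mem _
  · simpa [conjK_cU] using imageSubalgebra.smul_mem cU_mem _
  · simpa [conjK_Kinvel] using Kinvel_mem

theorem conjKinv_mem {x : Uq} (hx : x ∈ imageSubalgebra) : conjKinv x ∈ imageSubalgebra := by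
  suffices imageSubalgebra ≤ imageSubalgebra.comap conjKinv from this hx
  refine Algebra.adjoin_le ?_
  rintro _ (rfl | rfl | rfl | rfl)
  · simpa [conjKinv_aU] using aU_mem
  · simpa [conjKinv_Fel] using imageSubalgebra.smul_mem Fel_mem _
  · simpa [conjKinv_cU] using imageSubalgebra.smul_mem cU_mem _
  · simpa [conjKinv_Kinvel] using Kinvel_mem

/-! ### Reduction modulo the normal element `K⁻¹`

For `x` in `imageSubalgebra`, the condition `x * Kel ∈ imageSubalgebra` says that `x` lies in the
two-sided ideal generated by `K⁻¹`. -/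

theorem aU_commutator_Fel :
    (aU * Fel - Fel * aU) * Kel = (-(qv⁻¹ * (qv - qv⁻¹))) • Fel := by
  simp only [aU, mul_assoc, mul_add, add_mul, sub_mul, mul_sub, smul_mul_assoc, mul_smul_comm,
    smul_add, smul_sub, smul_smul, Eel_mul_Fel_mul, Eel_mul_Kel, Kel_mul_Fel_mul,
    Kinvel_mul_Kel, mul_one]
  have := qv_ne_zero
  have := qv_sq_sub_one_ne_zero
  match_scalars <;> field_simp <;> ring

theorem cU_commutator_Fel :
    (cU * Fel - Fel * cU) * Kel = (qv - qv⁻¹)⁻¹ • (aU - Kinvel) := by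
  simp only [aU, cU, mul_assoc, mul_add, sub_mul, mul_sub, mul_smul_comm,
    smul_add, smul_sub, smul_smul, Eel_mul_Fel_mul, Eel_mul_Kel, Kinvel_mul_Fel_mul,
    Kinvel_mul_Kel, Kinvel_mul_Kel_mul, mul_one]
  have := qv_ne_zero
  have := qv_sq_sub_one_ne_zero
  match_scalars <;> field_simp

theorem Kinvel_commutator_Fel :
    (Kinvel * Fel - Fel * Kinvel) * Kel = (qv ^ 2 - 1) • Fel := by
  simp only [mul_assoc, sub_mul, Kinvel_mul_Fel_mul, Kinvel_mul_Kel, mul_one]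
  module

theorem commutator_Fel_mul_Kel_mem {x : Uq} (hx : x ∈ imageSubalgebra) :
    (x * Fel - Fel * x) * Kel ∈ imageSubalgebra := by
  induction hx using Algebra.adjoin_induction with
  | mem x hx =>
    rcases hx with rfl | rfl | rfl | rfl
    · rw [aU_commutator_Fel]
      exact imageSubalgebra.smul_mem Fel_mem _
    · simp
    · rw [cU_commutator_Fel]
      exact imageSubalgebra.smul_mem (sub_mem aU_mem Kinvel_mem) _
    · rw [Kinvel_commutator_Fel]
      exact imageSubalgebra.smul_mem Fel_mem _
  | algebraMap r =>
    rw [Algebra.commutes, sub_self, zero_mul]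
    exact zero_mem _
  | add x y _ _ hx hy =>
    convert add_mem hx hy using 1
    noncomm_ring
  | mul x y hx hy hxF hyF =>
    have h : (x * y * Fel - Fel * (x * y)) * Kel =
        x * ((y * Fel - Fel * y) * Kel) + (x * Fel - Fel * x) * Kel * conjKinv y := by
      simp only [conjKinv_apply, mul_assoc, Kel_mul_Kinvel_mul]
      noncomm_ring
    rw [h]
    exact add_mem (mul_mem hx hyF) (mul_mem hxF (conjKinv_mem hy))

/-- `F` is invertible modulo the ideal generated by `K⁻¹`. -/
theorem cU_mul_Fel :
    cU * Fel = (qv / (qv - qv⁻¹) ^ 2) • (Kinvel * aU)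
      - (qv - qv⁻¹)⁻¹ • (Kinvel * Kinvel) - (qv⁻¹ / (qv - qv⁻¹) ^ 2) • 1 := by
  simp only [aU, cU, mul_assoc, mul_add, mul_sub, mul_smul_comm,
    smul_add, smul_sub, smul_smul, Eel_mul_Fel, Kinvel_mul_Kel]
  have := qv_ne_zero
  have := qv_sq_sub_one_ne_zero
  match_scalars <;> field_simp

theorem mul_Kel_mem_of_Fel_mul {x : Uq} (hx : x ∈ imageSubalgebra)
    (h : Fel * x * Kel ∈ imageSubalgebra) : x * Kel ∈ imageSubalgebra := by
  have hK {y : Uq} (hy : y ∈ imageSubalgebra) : Kinvel * y * Kel ∈ imageSubalgebra := by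
    simpa only [conjKinv_apply, mul_assoc] using conjKinv_mem hy
  have key : (qv⁻¹ / (qv - qv⁻¹) ^ 2) • (x * Kel) =
      (qv / (qv - qv⁻¹) ^ 2) • (Kinvel * (aU * x) * Kel)
        - (qv - qv⁻¹)⁻¹ • (Kinvel * (Kinvel * x) * Kel) - cU * (Fel * x * Kel) := by
    have h' : cU * (Fel * x * Kel) = cU * Fel * x * Kel := by simp only [mul_assoc]
    rw [h', cU_mul_Fel]
    simp only [sub_mul, smul_mul_assoc, one_mul, mul_assoc]
    abel
  have hmem : (qv⁻¹ / (qv - qv⁻¹) ^ 2) • (x * Kel) ∈ imageSubalgebra := by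
    rw [key]
    exact sub_mem (sub_mem (imageSubalgebra.smul_mem (hK (mul_mem aU_mem hx)) _)
      (imageSubalgebra.smul_mem (hK (mul_mem Kinvel_mem hx)) _)) (mul_mem cU_mem h)
  have ht : qv⁻¹ / (qv - qv⁻¹) ^ 2 ≠ 0 :=
    div_ne_zero (inv_ne_zero qv_ne_zero) (pow_ne_zero _ qv_sub_inv_ne_zero)
  exact (Submodule.smul_mem_iff (Subalgebra.toSubmodule imageSubalgebra) ht).1 hmem

/-! ### The filtration of `U_q` by powers of `K` -/

/-- The subspace of those `x` with `x K⁻ᵐ` in the image of `Φ₁`. -/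
def poleFiltration (m : ℕ) : Submodule Kq Uq :=
  (Subalgebra.toSubmodule imageSubalgebra).comap (LinearMap.mulRight Kq (Kinvel ^ m))

theorem mem_poleFiltration {m : ℕ} {x : Uq} :
    x ∈ poleFiltration m ↔ x * Kinvel ^ m ∈ imageSubalgebra := Iff.rfl

theorem mem_poleFiltration_zero {x : Uq} : x ∈ poleFiltration 0 ↔ x ∈ imageSubalgebra := by
  rw [mem_poleFiltration, pow_zero, mul_one]

theorem poleFiltration_mono : Monotone poleFiltration := by
  refine monotone_nat_of_le_succ fun m x hx => ?_
  rw [mem_poleFiltration] at hx ⊢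
  rw [pow_succ, ← mul_assoc]
  exact mul_mem hx Kinvel_mem

theorem mul_mem_poleFiltration {m n : ℕ} {x y : Uq} (hx : x ∈ poleFiltration m)
    (hy : y ∈ poleFiltration n) : x * y ∈ poleFiltration (m + n) := by
  induction m generalizing x y with
  | zero =>
    rw [mem_poleFiltration, zero_add, mul_assoc]
    exact mul_mem (mem_poleFiltration_zero.1 hx) hy
  | succ m ih =>
    have hx' : x * Kinvel ∈ poleFiltration m := by
      rw [mem_poleFiltration, mul_assoc, ← pow_succ']
      exact hx
    have hy' : conjK y ∈ poleFiltration n := by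
      have h := conjK_mem hy
      rwa [LinearMap.mulRight_apply, map_mul, map_pow, conjK_Kinvel] at h
    have h := ih hx' hy'
    have hxy : x * Kinvel * conjK y = x * y * Kinvel := by
      simp only [conjK_apply, mul_assoc, Kinvel_mul_Kel_mul]
    rw [hxy, mem_poleFiltration, mul_assoc, ← pow_succ'] at h
    rwa [mem_poleFiltration, add_right_comm]

theorem Uq_adjoin_eq_top : Algebra.adjoin Kq {Eel, Fel, Kel, Kinvel} = ⊤ := by
  have h := congrArg (Subalgebra.map (RingQuot.mkAlgHom Kq URel))
    (FreeAlgebra.adjoin_range_ι Kq UGen)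
  rw [AlgHom.map_adjoin, Algebra.map_top,
    (AlgHom.range_eq_top _).2 (RingQuot.mkAlgHom_surjective Kq URel)] at h
  rw [← top_le_iff, ← h]
  refine Algebra.adjoin_mono ?_
  rintro _ ⟨_, ⟨g, rfl⟩, rfl⟩
  cases g
  exacts [Or.inl rfl, Or.inr (Or.inl rfl), Or.inr (Or.inr (Or.inl rfl)),
    Or.inr (Or.inr (Or.inr rfl))]

theorem exists_mem_poleFiltration (x : Uq) : ∃ m, x ∈ poleFiltration m := by
  have hx : x ∈ Algebra.adjoin Kq {Eel, Fel, Kel, Kinvel} := Uq_adjoin_eq_top ▸ Algebra.mem_top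
  have hK : Kel ∈ poleFiltration 1 := by
    rw [mem_poleFiltration, pow_one, Kel_mul_Kinvel]
    exact one_mem _
  induction hx using Algebra.adjoin_induction with
  | mem x hx =>
    rcases hx with rfl | rfl | rfl | rfl
    · refine ⟨1, ?_⟩
      have h := mul_mem_poleFiltration hK (mem_poleFiltration_zero.2 cU_mem)
      rwa [cU, Kel_mul_Kinvel_mul] at h
    · exact ⟨0, mem_poleFiltration_zero.2 Fel_mem⟩
    · exact ⟨1, hK⟩
    · exact ⟨0, mem_poleFiltration_zero.2 Kinvel_mem⟩
  | algebraMap r => exact ⟨0, mem_poleFiltration_zero.2 (imageSubalgebra.algebraMap_mem r)⟩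
  | add x y _ _ hx hy =>
    obtain ⟨m, hm⟩ := hx
    obtain ⟨n, hn⟩ := hy
    exact ⟨max m n, add_mem (poleFiltration_mono (le_max_left _ _) hm)
      (poleFiltration_mono (le_max_right _ _) hn)⟩
  | mul x y _ _ hx hy =>
    obtain ⟨m, hm⟩ := hx
    obtain ⟨n, hn⟩ := hy
    exact ⟨m + n, mul_mem_poleFiltration hm hn⟩

theorem exists_le_poleFiltration (W : Submodule Kq Uq) [FiniteDimensional Kq W] :
    ∃ m, W ≤ poleFiltration m := by
  have hW : W.FG := Module.Finite.iff_fg.1 inferInstance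
  obtain ⟨s, rfl⟩ := hW
  choose f hf using exists_mem_poleFiltration
  exact ⟨s.sup f, Submodule.span_le.2 fun x hx =>
    poleFiltration_mono (Finset.le_sup (f := f) hx) (hf x)⟩

/-! ### The adjoint action of the generators -/

/-- The right adjoint action of `E`. -/
def adE : Uq →ₗ[Kq] Uq :=
  LinearMap.mulRight Kq Eel -
    LinearMap.mulLeft Kq Eel ∘ₗ conjKinv.toLinearMap

/-- The right adjoint action of `F`. -/
def adF : Uq →ₗ[Kq] Uq :=
  LinearMap.mulLeft Kq Kel ∘ₗ (LinearMap.mulRight Kq Fel - LinearMap.mulLeft Kq Fel)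

theorem adE_apply (x : Uq) : adE x = x * Eel - Eel * conjKinv x := rfl
theorem adF_apply (x : Uq) : adF x = Kel * (x * Fel - Fel * x) := rfl

theorem adE_mul (x y : Uq) : adE (x * y) = x * adE y + adE x * conjKinv y := by
  simp only [adE_apply, map_mul]
  noncomm_ring

theorem adF_mul (x y : Uq) : adF (x * y) = conjK x * adF y + adF x * y := by
  simp only [adF_apply, conjK_apply, mul_assoc, Kinvel_mul_Kel_mul]
  noncomm_ring

theorem adF_mul_Kinvel_pow (x : Uq) (m : ℕ) :
    adF x * Kinvel ^ (m + 1) =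
      (qv⁻¹ ^ 2) ^ (m + 1) • (conjK (x * Kinvel ^ m) * Fel)
        - (qv⁻¹ ^ 2) • (Fel * conjK (x * Kinvel ^ m)) := by
  have h₁ : adF x * Kinvel ^ (m + 1) =
      Kel * (x * (Fel * Kinvel ^ (m + 1))) - Kel * (Fel * (x * Kinvel ^ (m + 1))) := by
    rw [adF_apply]
    noncomm_ring
  rw [h₁, Fel_mul_Kinvel_pow, Kel_mul_Fel_mul]
  simp only [conjK_apply, pow_succ, mul_smul_comm, mul_assoc]

theorem adF_mem_poleFiltration_succ {m : ℕ} {x : Uq} (hx : x ∈ poleFiltration m) :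
    adF x ∈ poleFiltration (m + 1) := by
  rw [mem_poleFiltration, adF_mul_Kinvel_pow]
  have h := conjK_mem hx
  exact sub_mem (imageSubalgebra.smul_mem (mul_mem h Fel_mem) _)
    (imageSubalgebra.smul_mem (mul_mem Fel_mem h) _)

/-- The adjoint action of `F` strictly raises the order of a nontrivial pole. -/
theorem mem_poleFiltration_of_adF_mem {m : ℕ} {x : Uq} (hx : x ∈ poleFiltration (m + 1))
    (h : adF x ∈ poleFiltration (m + 1)) : x ∈ poleFiltration m := by
  set y := x * Kinvel ^ (m + 1) with hy
  have hyL : conjK y ∈ imageSubalgebra := conjK_mem hx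
  have hadF : adF x * Kinvel ^ (m + 2) * Kel ∈ imageSubalgebra := by
    rw [pow_succ, mul_assoc, mul_assoc, Kinvel_mul_Kel, mul_one]
    exact h
  rw [adF_mul_Kinvel_pow, ← hy] at hadF
  have hcomm := imageSubalgebra.smul_mem (commutator_Fel_mul_Kel_mem hyL) ((qv⁻¹ ^ 2) ^ (m + 2))
  have hF := sub_mem hadF hcomm
  have heq : ((qv⁻¹ ^ 2) ^ (m + 1 + 1) • (conjK y * Fel) - (qv⁻¹ ^ 2) • (Fel * conjK y)) * Kel
      - (qv⁻¹ ^ 2) ^ (m + 2) • ((conjK y * Fel - Fel * conjK y) * Kel)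
      = ((qv⁻¹ ^ 2) ^ (m + 2) - qv⁻¹ ^ 2) • (Fel * conjK y * Kel) := by
    simp only [sub_mul, smul_mul_assoc]
    module
  rw [heq] at hF
  have ht : (qv⁻¹ ^ 2) ^ (m + 2) - qv⁻¹ ^ 2 ≠ 0 := by
    have h1 : qv ^ (2 * (m + 1)) ≠ 1 := qv_pow_ne_one (by omega)
    have h2 : (qv⁻¹ ^ 2) ^ (m + 2) - qv⁻¹ ^ 2
        = qv⁻¹ ^ 2 * (qv ^ (2 * (m + 1)))⁻¹ * (1 - qv ^ (2 * (m + 1))) := by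
      have := qv_ne_zero
      simp only [inv_pow]
      field_simp
      ring
    rw [h2]
    exact mul_ne_zero (mul_ne_zero (pow_ne_zero _ (inv_ne_zero qv_ne_zero))
      (inv_ne_zero (pow_ne_zero _ qv_ne_zero))) (sub_ne_zero.2 h1.symm)
  have hyK := mul_Kel_mem_of_Fel_mul hyL
    ((Submodule.smul_mem_iff (Subalgebra.toSubmodule imageSubalgebra) ht).1 hF)
  have hfin := conjKinv_mem hyK
  have hK : conjKinv (conjK y * Kel) = x * Kinvel ^ m := by
    rw [map_mul, conjKinv_conjK, hy, conjKinv_apply, Kinvel_mul_Kel_mul, pow_succ, mul_assoc,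
      mul_assoc, Kinvel_mul_Kel, mul_one]
  rw [hK] at hfin
  exact hfin

theorem adF_iterate_mem_poleFiltration {m : ℕ} {x : Uq} (hx : x ∈ poleFiltration (m + 1))
    (hx' : x ∉ poleFiltration m) (n : ℕ) :
    adF^[n] x ∈ poleFiltration (m + n + 1) ∧ adF^[n] x ∉ poleFiltration (m + n) := by
  induction n with
  | zero => exact ⟨hx, hx'⟩
  | succ n ih =>
    rw [Function.iterate_succ_apply']
    exact ⟨adF_mem_poleFiltration_succ ih.1,
      fun h => ih.2 (mem_poleFiltration_of_adF_mem ih.1 h)⟩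

/-- An element whose `adF`-orbit lies in a finite dimensional subspace has no pole. -/
theorem mem_imageSubalgebra_of_adF_iterate_mem {x : Uq} (W : Submodule Kq Uq)
    [FiniteDimensional Kq W] (hW : ∀ n, adF^[n] x ∈ W) : x ∈ imageSubalgebra := by
  obtain ⟨M, hM⟩ := exists_le_poleFiltration W
  rw [← mem_poleFiltration_zero]
  by_contra hx
  obtain ⟨m, hm, hm'⟩ : ∃ m, x ∉ poleFiltration m ∧ x ∈ poleFiltration (m + 1) := by
    by_contra! h
    obtain ⟨m, hm⟩ := exists_mem_poleFiltration x
    exact Nat.rec hx (fun m hm => h m hm) m hm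
  exact (adF_iterate_mem_poleFiltration hm' hm M).2
    (poleFiltration_mono (Nat.le_add_left M m) (hM (hW M)))

/-! ### Elements of the image are locally finite -/

/-- A subspace stable under the adjoint action of the generators of `U_q`. -/
structure IsAdStable (W : Submodule Kq Uq) : Prop where
  adE : ∀ x ∈ W, adE x ∈ W
  adF : ∀ x ∈ W, adF x ∈ W
  conjK : ∀ x ∈ W, conjK x ∈ W
  conjKinv : ∀ x ∈ W, conjKinv x ∈ W

theorem IsAdStable.sup {V W : Submodule Kq Uq} (hV : IsAdStable V) (hW : IsAdStable W) :
    IsAdStable (V ⊔ W) := by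
  have key (f : Uq →ₗ[Kq] Uq) (h₁ : ∀ x ∈ V, f x ∈ V) (h₂ : ∀ x ∈ W, f x ∈ W) :
      ∀ x ∈ V ⊔ W, f x ∈ V ⊔ W := fun x hx =>
    (sup_le (fun y hy => Submodule.mem_sup_left (h₁ y hy))
      (fun y hy => Submodule.mem_sup_right (h₂ y hy)) :
      V ⊔ W ≤ (V ⊔ W).comap f) hx
  exact ⟨key _ hV.adE hW.adE, key _ hV.adF hW.adF,
    key _root_.conjK.toLinearMap hV.conjK hW.conjK,
    key _root_.conjKinv.toLinearMap hV.conjKinv hW.conjKinv⟩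

theorem IsAdStable.mul {V W : Submodule Kq Uq} (hV : IsAdStable V) (hW : IsAdStable W) :
    IsAdStable (V * W) := by
  have key (f : Uq →ₗ[Kq] Uq) (h : ∀ x ∈ V, ∀ y ∈ W, f (x * y) ∈ V * W) :
      ∀ x ∈ V * W, f x ∈ V * W := fun x hx =>
    (Submodule.mul_le.2 h : V * W ≤ (V * W).comap f) hx
  refine ⟨key _ fun x hx y hy => ?_, key _ fun x hx y hy => ?_,
    key _root_.conjK.toLinearMap fun x hx y hy => ?_,
    key _root_.conjKinv.toLinearMap fun x hx y hy => ?_⟩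
  · rw [adE_mul]
    exact add_mem (Submodule.mul_mem_mul hx (hW.adE y hy))
      (Submodule.mul_mem_mul (hV.adE x hx) (hW.conjKinv y hy))
  · rw [adF_mul]
    exact add_mem (Submodule.mul_mem_mul (hV.conjK x hx) (hW.adF y hy))
      (Submodule.mul_mem_mul (hV.adF x hx) hy)
  · rw [AlgHom.toLinearMap_apply, map_mul]
    exact Submodule.mul_mem_mul (hV.conjK x hx) (hW.conjK y hy)
  · rw [AlgHom.toLinearMap_apply, map_mul]
    exact Submodule.mul_mem_mul (hV.conjKinv x hx) (hW.conjKinv y hy)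

theorem IsAdStable.span {s : Set Uq} (hE : ∀ x ∈ s, _root_.adE x ∈ Submodule.span Kq s)
    (hF : ∀ x ∈ s, _root_.adF x ∈ Submodule.span Kq s)
    (hK : ∀ x ∈ s, _root_.conjK x ∈ Submodule.span Kq s)
    (hKinv : ∀ x ∈ s, _root_.conjKinv x ∈ Submodule.span Kq s) :
    IsAdStable (Submodule.span Kq s) := by
  have key (f : Uq →ₗ[Kq] Uq) (h : ∀ x ∈ s, f x ∈ Submodule.span Kq s) :
      ∀ x ∈ Submodule.span Kq s, f x ∈ Submodule.span Kq s := fun x hx =>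
    (Submodule.span_le.2 h : Submodule.span Kq s ≤ (Submodule.span Kq s).comap f) hx
  exact ⟨key _ hE, key _ hF, key _root_.conjK.toLinearMap hK,
    key _root_.conjKinv.toLinearMap hKinv⟩

theorem isAdStable_one : IsAdStable (1 : Submodule Kq Uq) := by
  rw [Submodule.one_eq_span]
  refine IsAdStable.span ?_ ?_ ?_ ?_ <;> rintro _ rfl
  · simp [adE_apply]
  · simp [adF_apply]
  · rw [map_one]
    exact Submodule.mem_span_singleton_self 1
  · rw [map_one]
    exact Submodule.mem_span_singleton_self 1

theorem adE_aU : adE aU = (qv⁻¹ * (qv - qv⁻¹)) • cU := by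
  rw [adE_apply, conjKinv_aU]
  simp only [aU, cU, mul_assoc, mul_add, add_mul, smul_mul_assoc, mul_smul_comm,
    smul_add, smul_sub, smul_smul, Eel_mul_Fel_mul, Eel_mul_Kel]
  have := qv_ne_zero
  have := qv_sq_sub_one_ne_zero
  match_scalars <;> field_simp <;> ring

theorem adE_Fel : adE Fel = (-(qv ^ 2 * (qv - qv⁻¹)⁻¹)) • (aU - Kinvel) := by
  rw [adE_apply, conjKinv_Fel]
  simp only [aU, mul_smul_comm, Eel_mul_Fel, smul_add, smul_sub, smul_smul]
  have := qv_ne_zero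
  have := qv_sq_sub_one_ne_zero
  match_scalars <;> field_simp
  ring

theorem adE_cU : adE cU = 0 := by
  rw [adE_apply, conjKinv_cU]
  simp only [cU, mul_smul_comm, Eel_mul_Kinvel_mul, smul_smul, mul_assoc,
    inv_mul_cancel₀ (pow_ne_zero 2 qv_ne_zero), one_smul, sub_self]

theorem adE_Kinvel : adE Kinvel = (1 - qv ^ 2) • cU := by
  rw [adE_apply, conjKinv_Kinvel, Eel_mul_Kinvel, cU]
  module

theorem adF_eq (x : Uq) : adF x = conjK ((x * Fel - Fel * x) * Kel) := by
  simp only [adF_apply, conjK_apply, mul_assoc, Kel_mul_Kinvel, mul_one]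

/-- The span of the images of `a`, `b`, `c`, `d` under `Φ₁`. -/
def generatorSpan : Submodule Kq Uq := Submodule.span Kq {aU, Fel, cU, Kinvel}

theorem aU_mem_generatorSpan : aU ∈ generatorSpan := Submodule.subset_span (by simp)
theorem Fel_mem_generatorSpan : Fel ∈ generatorSpan := Submodule.subset_span (by simp)
theorem cU_mem_generatorSpan : cU ∈ generatorSpan := Submodule.subset_span (by simp)
theorem Kinvel_mem_generatorSpan : Kinvel ∈ generatorSpan := Submodule.subset_span (by simp)

theorem isAdStable_generatorSpan : IsAdStable generatorSpan := by
  have ha := aU_mem_generatorSpan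
  have hb := Fel_mem_generatorSpan
  have hc := cU_mem_generatorSpan
  have hd := Kinvel_mem_generatorSpan
  refine IsAdStable.span ?_ ?_ ?_ ?_ <;> change ∀ x ∈ _, _ ∈ generatorSpan <;>
    rintro _ (rfl | rfl | rfl | rfl)
  · exact adE_aU ▸ generatorSpan.smul_mem _ hc
  · exact adE_Fel ▸ generatorSpan.smul_mem _ (sub_mem ha hd)
  · exact adE_cU ▸ zero_mem _
  · exact adE_Kinvel ▸ generatorSpan.smul_mem _ hc
  · rw [adF_eq, aU_commutator_Fel, map_smul, conjK_Fel]
    exact generatorSpan.smul_mem _ (generatorSpan.smul_mem _ hb)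
  · simp [adF_eq]
  · rw [adF_eq, cU_commutator_Fel, map_smul, map_sub, conjK_aU, conjK_Kinvel]
    exact generatorSpan.smul_mem _ (sub_mem ha hd)
  · rw [adF_eq, Kinvel_commutator_Fel, map_smul, conjK_Fel]
    exact generatorSpan.smul_mem _ (generatorSpan.smul_mem _ hb)
  · exact conjK_aU.symm ▸ ha
  · exact conjK_Fel ▸ generatorSpan.smul_mem _ hb
  · exact conjK_cU ▸ generatorSpan.smul_mem _ hc
  · exact conjK_Kinvel.symm ▸ hd
  · exact conjKinv_aU.symm ▸ ha
  · exact conjKinv_Fel ▸ generatorSpan.smul_mem _ hb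
  · exact conjKinv_cU ▸ generatorSpan.smul_mem _ hc
  · exact conjKinv_Kinvel.symm ▸ hd

theorem exists_isAdStable_of_mem {x : Uq} (hx : x ∈ imageSubalgebra) :
    ∃ W : Submodule Kq Uq, W.FG ∧ IsAdStable W ∧ x ∈ W := by
  induction hx using Algebra.adjoin_induction with
  | mem x hx =>
    exact ⟨generatorSpan, Submodule.fg_span (by simp), isAdStable_generatorSpan,
      Submodule.subset_span hx⟩
  | algebraMap r =>
    exact ⟨1, Submodule.one_eq_span (R := Kq) (A := Uq) ▸ Submodule.fg_span_singleton _,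
      isAdStable_one, Submodule.algebraMap_mem r⟩
  | add x y _ _ hx hy =>
    obtain ⟨V, hV, hV', hx⟩ := hx
    obtain ⟨W, hW, hW', hy⟩ := hy
    exact ⟨V ⊔ W, hV.sup hW, hV'.sup hW',
      add_mem (Submodule.mem_sup_left hx) (Submodule.mem_sup_right hy)⟩
  | mul x y _ _ hx hy =>
    obtain ⟨V, hV, hV', hx⟩ := hx
    obtain ⟨W, hW, hW', hy⟩ := hy
    exact ⟨V * W, hV.mul hW, hV'.mul hW', Submodule.mul_mem_mul hx hy⟩

/-! ### The adjoint action -/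

section adr

variable (Smap : Uq →ₗ[Kq] Uq) (Δmap : Uq →ₐ[Kq] Uq ⊗[Kq] Uq)

theorem adr_add (y z x : Uq) :
    adr Smap Δmap (y + z) x = adr Smap Δmap y x + adr Smap Δmap z x := by
  simp [adr]

theorem adr_algebraMap (hSone : Smap 1 = 1) (r : Kq) (x : Uq) :
    adr Smap Δmap (algebraMap Kq Uq r) x = r • x := by
  simp [adr, Algebra.algebraMap_eq_smul_one, Algebra.TensorProduct.one_def, adrBil, hSone]

theorem lift_adrBil_mul (hSmul : ∀ u v : Uq, Smap (u * v) = Smap v * Smap u)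
    (x : Uq) (s t : Uq ⊗[Kq] Uq) :
    TensorProduct.lift (adrBil Smap x) (s * t) =
      TensorProduct.lift (adrBil Smap (TensorProduct.lift (adrBil Smap x) s)) t := by
  induction t with
  | zero => simp
  | add t t' ht ht' => rw [mul_add, map_add, map_add, ht, ht']
  | tmul u v =>
    induction s with
    | zero => simp [adrBil]
    | add s s' hs hs' =>
      rw [add_mul, map_add, map_add, hs, hs']
      simp [adrBil, mul_add, add_mul]
    | tmul u' v' => simp [adrBil, hSmul, mul_assoc]

theorem adr_mul (hSmul : ∀ u v : Uq, Smap (u * v) = Smap v * Smap u) (y z x : Uq) :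
    adr Smap Δmap (y * z) x = adr Smap Δmap z (adr Smap Δmap y x) := by
  rw [adr, map_mul, lift_adrBil_mul Smap hSmul]
  rfl

variable {Smap Δmap}

theorem adr_Eel (hSone : Smap 1 = 1) (hSE : Smap Eel = -(Eel * Kinvel))
    (hΔE : Δmap Eel = Eel ⊗ₜ[Kq] Kel + 1 ⊗ₜ[Kq] Eel) (x : Uq) :
    adr Smap Δmap Eel x = adE x := by
  simp only [adr, hΔE, map_add, TensorProduct.lift.tmul, adrBil, LinearMap.mk₂_apply, hSE, hSone,
    adE_apply, conjKinv_apply, one_mul, neg_mul, mul_assoc]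
  abel

theorem adr_Fel (hSF : Smap Fel = -(Kel * Fel)) (hSKinv : Smap Kinvel = Kel)
    (hΔF : Δmap Fel = Kinvel ⊗ₜ[Kq] Fel + Fel ⊗ₜ[Kq] 1) (x : Uq) :
    adr Smap Δmap Fel x = adF x := by
  simp only [adr, hΔF, map_add, TensorProduct.lift.tmul, adrBil, LinearMap.mk₂_apply, hSF, hSKinv,
    adF_apply, mul_one, neg_mul, mul_assoc, mul_sub]
  abel

theorem adr_Kel (hSK : Smap Kel = Kinvel) (hΔK : Δmap Kel = Kel ⊗ₜ[Kq] Kel) (x : Uq) :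
    adr Smap Δmap Kel x = conjKinv x := by
  simp only [adr, hΔK, TensorProduct.lift.tmul, adrBil, LinearMap.mk₂_apply, hSK,
    conjKinv_apply, mul_assoc]

theorem adr_Kinvel (hSKinv : Smap Kinvel = Kel) (hΔKinv : Δmap Kinvel = Kinvel ⊗ₜ[Kq] Kinvel)
    (x : Uq) : adr Smap Δmap Kinvel x = conjK x := by
  simp only [adr, hΔKinv, TensorProduct.lift.tmul, adrBil, LinearMap.mk₂_apply, hSKinv,
    conjK_apply, mul_assoc]

theorem adr_mem_of_isAdStable
    (hE : ∀ x, adr Smap Δmap Eel x = adE x) (hF : ∀ x, adr Smap Δmap Fel x = adF x)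
    (hK : ∀ x, adr Smap Δmap Kel x = conjKinv x)
    (hKinv : ∀ x, adr Smap Δmap Kinvel x = conjK x)
    (hSmul : ∀ u v : Uq, Smap (u * v) = Smap v * Smap u) (hSone : Smap 1 = 1)
    {W : Submodule Kq Uq} (hW : IsAdStable W) (y : Uq) :
    ∀ x ∈ W, adr Smap Δmap y x ∈ W := by
  have hy : y ∈ Algebra.adjoin Kq {Eel, Fel, Kel, Kinvel} := Uq_adjoin_eq_top ▸ Algebra.mem_top
  induction hy using Algebra.adjoin_induction with
  | mem y hy =>
    intro x hx
    rcases hy with rfl | rfl | rfl | rfl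
    · exact (hE x).symm ▸ hW.adE x hx
    · exact (hF x).symm ▸ hW.adF x hx
    · exact (hK x).symm ▸ hW.conjKinv x hx
    · exact (hKinv x).symm ▸ hW.conjK x hx
  | algebraMap r =>
    intro x hx
    rw [adr_algebraMap Smap Δmap hSone]
    exact W.smul_mem r hx
  | add y z _ _ hy hz =>
    intro x hx
    rw [adr_add]
    exact add_mem (hy x hx) (hz x hx)
  | mul y z _ _ hy hz =>
    intro x hx
    rw [adr_mul Smap Δmap hSmul]
    exact hz _ (hy x hx)

end adr

theorem Aalg_adjoin_eq_top : Algebra.adjoin Kq {aA, bA, cA, dA} = ⊤ := by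
  have h := congrArg (Subalgebra.map (RingQuot.mkAlgHom Kq ARel))
    (FreeAlgebra.adjoin_range_ι Kq AGen)
  rw [AlgHom.map_adjoin, Algebra.map_top,
    (AlgHom.range_eq_top _).2 (RingQuot.mkAlgHom_surjective Kq ARel)] at h
  rw [← top_le_iff, ← h]
  refine Algebra.adjoin_mono ?_
  rintro _ ⟨_, ⟨g, rfl⟩, rfl⟩
  cases g
  exacts [Or.inl rfl, Or.inr (Or.inl rfl), Or.inr (Or.inr (Or.inl rfl)),
    Or.inr (Or.inr (Or.inr rfl))]

theorem range_eq_imageSubalgebra (Φ : Aalg →ₐ[Kq] Uq)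
    (hΦa : Φ aA = Kel + (qv⁻¹ * (qv - qv⁻¹) ^ 2) • (Fel * Eel))
    (hΦb : Φ bA = (qv⁻¹ * (qv - qv⁻¹)) • Fel)
    (hΦc : Φ cA = (qv - qv⁻¹) • (Kinvel * Eel))
    (hΦd : Φ dA = Kinvel) : Φ.range = imageSubalgebra := by
  apply le_antisymm
  · rw [← Algebra.map_top, ← Aalg_adjoin_eq_top, AlgHom.map_adjoin]
    refine Algebra.adjoin_le ?_
    rintro _ ⟨_, (rfl | rfl | rfl | rfl), rfl⟩
    · exact hΦa ▸ aU_mem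
    · exact hΦb ▸ imageSubalgebra.smul_mem Fel_mem _
    · exact hΦc ▸ imageSubalgebra.smul_mem cU_mem _
    · exact hΦd ▸ Kinvel_mem
  · refine Algebra.adjoin_le ?_
    rintro _ (rfl | rfl | rfl | rfl)
    · exact ⟨aA, hΦa⟩
    · refine ⟨(qv⁻¹ * (qv - qv⁻¹))⁻¹ • bA, ?_⟩
      change Φ _ = _
      rw [map_smul, hΦb, inv_smul_smul₀ (mul_ne_zero (inv_ne_zero qv_ne_zero) qv_sub_inv_ne_zero)]
    · refine ⟨(qv - qv⁻¹)⁻¹ • cA, ?_⟩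
      change Φ _ = _
      rw [map_smul, hΦc, inv_smul_smul₀ qv_sub_inv_ne_zero, cU]
    · exact ⟨dA, hΦd⟩

end

/-- The image of `Φ₁` equals the set of locally finite elements
`U_q^{lf} = {x ∈ U_q : ad^r(U_q)(x) spans a finite dimensional ℂ(q)-subspace}`.
Here the Hopf algebra structure of `U_q` (coproduct `Δ` and antipode `S`) is specified by
its values on the generators. -/
theorem statement4 (Φ : Aalg →ₐ[Kq] Uq)
    (hΦa : Φ aA = Kel + (qv⁻¹ * (qv - qv⁻¹) ^ 2) • (Fel * Eel))
    (hΦb : Φ bA = (qv⁻¹ * (qv - qv⁻¹)) • Fel)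
    (hΦc : Φ cA = (qv - qv⁻¹) • (Kinvel * Eel))
    (hΦd : Φ dA = Kinvel)
    (Δmap : Uq →ₐ[Kq] Uq ⊗[Kq] Uq)
    (hΔE : Δmap Eel = Eel ⊗ₜ[Kq] Kel + 1 ⊗ₜ[Kq] Eel)
    (hΔF : Δmap Fel = Kinvel ⊗ₜ[Kq] Fel + Fel ⊗ₜ[Kq] 1)
    (hΔK : Δmap Kel = Kel ⊗ₜ[Kq] Kel)
    (hΔKinv : Δmap Kinvel = Kinvel ⊗ₜ[Kq] Kinvel)
    (Smap : Uq →ₗ[Kq] Uq)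
    (hSmul : ∀ u v : Uq, Smap (u * v) = Smap v * Smap u)
    (hSone : Smap 1 = 1)
    (hSE : Smap Eel = -(Eel * Kinvel))
    (hSF : Smap Fel = -(Kel * Fel))
    (hSK : Smap Kel = Kinvel)
    (hSKinv : Smap Kinvel = Kel) :
    ∀ x : Uq, (x ∈ Set.range Φ) ↔
      FiniteDimensional Kq
        ↥(Submodule.span Kq (Set.range fun y : Uq => adr Smap Δmap y x)) := by
  have hE := adr_Eel hSone hSE hΔE
  have hF := adr_Fel hSF hSKinv hΔF
  have hK := adr_Kel hSK hΔK
  have hKinv := adr_Kinvel hSKinv hΔKinv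
  intro x
  rw [← AlgHom.coe_range, range_eq_imageSubalgebra Φ hΦa hΦb hΦc hΦd, SetLike.mem_coe]
  constructor
  · intro hx
    obtain ⟨W, hWfg, hW, hxW⟩ := exists_isAdStable_of_mem hx
    have : FiniteDimensional Kq W := Module.Finite.iff_fg.2 hWfg
    refine Submodule.finiteDimensional_of_le (S₂ := W) (Submodule.span_le.2 ?_)
    rintro _ ⟨y, rfl⟩
    exact adr_mem_of_isAdStable hE hF hK hKinv hSmul hSone hW y x hxW
  · intro hfin
    refine mem_imageSubalgebra_of_adF_iterate_mem
      (Submodule.span Kq (Set.range fun y : Uq => adr Smap Δmap y x))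
      fun n => Submodule.subset_span ⟨Fel ^ n, ?_⟩
    change adr Smap Δmap (Fel ^ n) x = adF^[n] x
    induction n with
    | zero =>
      have h := adr_algebraMap Smap Δmap hSone 1 x
      rw [map_one, one_smul] at h
      rwa [pow_zero]
    | succ n ih => rw [pow_succ, adr_mul Smap Δmap hSmul, ih, hF, Function.iterate_succ_apply']
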